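/- For every real x > 0, with q = e^{−πx/3} and ρ = e^{2πi/3}, one has F_{(1,4)}(x) = (25π²/(36x)) · Im( ∫ φ(u)²·ψ(u²)⁴ du ), where the integral is taken over the straight line segment in ℂ from 0 to ρ·q. -/

import Mathlib

open Real Filter Topology

/-- The two-dimensional lattice sum `F_{(1,4)}(x)`. -/
noncomputable def F14 (x : ℝ) : ℝ :=
  25 * ∑' p : ℤ × ℤ, (-1:ℝ)^(p.1) * (3*(p.2:ℝ)+1) /
    (4*(3*(p.2:ℝ)+1)^2 + x^2*(6*(p.1:ℝ)+1)^2)^2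

/-- Ramanujan's theta function `φ(q) = Σ_{n∈ℤ} q^{n²}` (complex argument). -/
noncomputable def phiC (q : ℂ) : ℂ := ∑' n : ℤ, q^(n^2)

/-- Ramanujan's theta function `ψ(q) = Σ_{n≥0} q^{n(n+1)/2}` (complex argument). -/
noncomputable def psiC (q : ℂ) : ℂ := ∑' n : ℕ, q^(n*(n+1)/2)

/-! ### Summation over pairs of integers by parity -/

lemma neg_one_zpow_sq_eq (n : ℤ) : ((-1 : ℂ) ^ n) * (-1 : ℂ) ^ n = 1 := by
  rw [← mul_zpow]; simp

/-- The pairs with even coordinate sum are parametrized by `(a + b, a - b)`. -/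
lemma tsum_pair_even (w : ℤ → ℤ → ℂ) :
    ∑' p : ℤ × ℤ, (1 + (-1 : ℂ) ^ p.1 * (-1) ^ p.2) * w p.1 p.2 =
      2 * ∑' p : ℤ × ℤ, w (p.1 + p.2) (p.1 - p.2) := by
  have hinj : Function.Injective (fun p : ℤ × ℤ => (p.1 + p.2, p.1 - p.2)) := by
    rintro ⟨a, b⟩ ⟨c, d⟩ h
    simp only [Prod.mk.injEq] at h ⊢
    omega
  rw [← hinj.tsum_eq, ← tsum_mul_left]
  · refine tsum_congr fun p => ?_
    have : (-1 : ℂ) ^ (p.1 + p.2) * (-1) ^ (p.1 - p.2) = 1 := by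
      rw [← zpow_add₀ (by norm_num), show p.1 + p.2 + (p.1 - p.2) = p.1 + p.1 by ring,
        Even.neg_one_zpow ⟨p.1, rfl⟩]
    simp only [this]
    norm_num
  · rintro ⟨m, n⟩ hp
    rcases Int.even_or_odd (m + n) with h | h
    · obtain ⟨k, hk⟩ := h
      exact ⟨(k, m - k), by ext <;> simp; omega⟩
    · refine absurd ?_ hp
      simp [← zpow_add₀ (show (-1 : ℂ) ≠ 0 by norm_num), h.neg_one_zpow]

/-- The pairs with odd coordinate sum are parametrized by `(a + b + 1, a - b)`. -/
lemma tsum_pair_odd (w : ℤ → ℤ → ℂ) :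
    ∑' p : ℤ × ℤ, (1 - (-1 : ℂ) ^ p.1 * (-1) ^ p.2) * w p.1 p.2 =
      2 * ∑' p : ℤ × ℤ, w (p.1 + p.2 + 1) (p.1 - p.2) := by
  have hinj : Function.Injective (fun p : ℤ × ℤ => (p.1 + p.2 + 1, p.1 - p.2)) := by
    rintro ⟨a, b⟩ ⟨c, d⟩ h
    simp only [Prod.mk.injEq] at h ⊢
    omega
  rw [← hinj.tsum_eq, ← tsum_mul_left]
  · refine tsum_congr fun p => ?_
    have : (-1 : ℂ) ^ (p.1 + p.2 + 1) * (-1) ^ (p.1 - p.2) = -1 := by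
      rw [← zpow_add₀ (by norm_num), Odd.neg_one_zpow ⟨p.1, by ring⟩]
    simp only [this]
    norm_num
  · rintro ⟨m, n⟩ hp
    rcases Int.even_or_odd (m + n) with h | h
    · refine absurd ?_ hp
      simp [← zpow_add₀ (show (-1 : ℂ) ≠ 0 by norm_num), h.neg_one_zpow]
    · obtain ⟨k, hk⟩ := h
      exact ⟨(k, m - k - 1), by ext <;> simp <;> omega⟩

/-! ### Summability of theta-type series -/

lemma summable_natAbs_pow_mul_geometric (k : ℕ) {r : ℝ} (h0 : 0 ≤ r) (h1 : r < 1) :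
    Summable fun n : ℤ => (n.natAbs : ℝ) ^ k * r ^ n.natAbs := by
  have h := summable_pow_mul_geometric_of_norm_lt_one k (r := r)
    (by rwa [Real.norm_of_nonneg h0])
  exact Summable.of_nat_of_neg (by simpa using h) (by simpa using h)

lemma zpow_sq_eq_pow_natAbs (q : ℂ) (n : ℤ) : q ^ (n ^ 2) = q ^ (n.natAbs ^ 2) := by
  rw [← zpow_natCast]
  congr 1
  push_cast
  exact (sq_abs n).symm

lemma norm_zpow_sq_le {q : ℂ} (hq : ‖q‖ < 1) (n : ℤ) : ‖q ^ (n ^ 2)‖ ≤ ‖q‖ ^ n.natAbs := by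
  rw [zpow_sq_eq_pow_natAbs, norm_pow]
  exact pow_le_pow_of_le_one (norm_nonneg _) hq.le (Nat.le_self_pow (by norm_num) _)

lemma norm_neg_one_zpow (n : ℤ) : ‖(-1 : ℂ) ^ n‖ = 1 := by
  rw [norm_zpow]; simp

lemma norm_intCast_eq_natAbs (n : ℤ) : ‖(n : ℂ)‖ = (n.natAbs : ℝ) := by
  rw [Complex.norm_intCast, Nat.cast_natAbs, Int.cast_abs]

lemma summable_norm_pow_mul_zpow_sq (k : ℕ) {q : ℂ} (hq : ‖q‖ < 1) :
    Summable fun n : ℤ => ‖(n : ℂ) ^ k * q ^ (n ^ 2)‖ := by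
  refine Summable.of_nonneg_of_le (fun _ => norm_nonneg _) (fun n => ?_)
    (summable_natAbs_pow_mul_geometric k (norm_nonneg q) hq)
  rw [norm_mul, norm_pow, norm_intCast_eq_natAbs]
  gcongr
  exact norm_zpow_sq_le hq n

lemma summable_norm_zpow_sq {q : ℂ} (hq : ‖q‖ < 1) :
    Summable fun n : ℤ => ‖q ^ (n ^ 2)‖ := by
  simpa using summable_norm_pow_mul_zpow_sq 0 hq

/-- The derivative series `q φ'(q) = Σ n² q^{n²}`. -/
noncomputable def phiDerivC (q : ℂ) : ℂ := ∑' n : ℤ, (n : ℂ) ^ 2 * q ^ (n ^ 2)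

/-- The bilateral series `Σ_{n ∈ ℤ} q^{n(n+1)}`, which equals `2 ψ(q²)`. -/
noncomputable def psiBilateralC (q : ℂ) : ℂ := ∑' n : ℤ, q ^ (n * (n + 1))

lemma zpow_mul_succ_natCast (q : ℂ) (n : ℕ) :
    q ^ ((n : ℤ) * ((n : ℤ) + 1)) = q ^ (n * (n + 1)) := by
  rw [← zpow_natCast]; push_cast; rfl

lemma zpow_mul_succ_neg (q : ℂ) (n : ℕ) :
    q ^ (-((n : ℤ) + 1) * (-((n : ℤ) + 1) + 1)) = q ^ (n * (n + 1)) := by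
  rw [← zpow_natCast]; push_cast; congr 1; ring

lemma summable_norm_pow_mul_succ {q : ℂ} (hq : ‖q‖ < 1) :
    Summable fun n : ℕ => ‖q ^ (n * (n + 1))‖ := by
  refine Summable.of_nonneg_of_le (fun _ => norm_nonneg _) (fun n => ?_)
    (summable_geometric_of_lt_one (norm_nonneg q) hq)
  rw [norm_pow]
  exact pow_le_pow_of_le_one (norm_nonneg _) hq.le (by nlinarith)

lemma summable_norm_zpow_mul_succ {q : ℂ} (hq : ‖q‖ < 1) :
    Summable fun n : ℤ => ‖q ^ (n * (n + 1))‖ := by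
  refine Summable.of_nat_of_neg_add_one ?_ ?_
  · simpa only [zpow_mul_succ_natCast] using summable_norm_pow_mul_succ hq
  · simpa only [zpow_mul_succ_neg] using summable_norm_pow_mul_succ hq

lemma psiBilateralC_eq {q : ℂ} (hq : ‖q‖ < 1) : psiBilateralC q = 2 * psiC (q ^ 2) := by
  have h := (summable_norm_pow_mul_succ hq).of_norm
  have hpsi : psiC (q ^ 2) = ∑' n : ℕ, q ^ (n * (n + 1)) := by
    refine tsum_congr fun n => ?_
    rw [← pow_mul, Nat.mul_div_cancel' (Nat.even_mul_succ_self n).two_dvd]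
  rw [psiBilateralC, tsum_of_nat_of_neg_add_one, hpsi]
  · simp only [zpow_mul_succ_natCast, zpow_mul_succ_neg]
    ring
  · simpa only [zpow_mul_succ_natCast] using h
  · simpa only [zpow_mul_succ_neg] using h

lemma neg_zpow_sq (q : ℂ) (n : ℤ) : (-q) ^ (n ^ 2) = (-1) ^ n * q ^ (n ^ 2) := by
  rcases Int.even_or_odd n with h | h
  · rw [(h.pow_of_ne_zero two_ne_zero).neg_zpow, h.neg_one_zpow, one_mul]
  · rw [h.pow.neg_zpow, h.neg_one_zpow]; ring

/-! ### Quadratic identities between theta series -/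

section Quadratic

variable {q : ℂ}

lemma norm_sq_lt_one (hq : ‖q‖ < 1) : ‖q ^ 2‖ < 1 := by
  rw [norm_pow]; exact pow_lt_one₀ (norm_nonneg _) hq two_ne_zero

lemma phiC_neg (q : ℂ) : phiC (-q) = ∑' n : ℤ, (-1) ^ n * q ^ (n ^ 2) :=
  tsum_congr fun n => neg_zpow_sq q n

lemma phiDerivC_neg (q : ℂ) :
    phiDerivC (-q) = ∑' n : ℤ, (n : ℂ) ^ 2 * ((-1) ^ n * q ^ (n ^ 2)) :=
  tsum_congr fun n => by rw [neg_zpow_sq]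

lemma summable_norm_sign_mul_zpow_sq (hq : ‖q‖ < 1) :
    Summable fun n : ℤ => ‖(-1) ^ n * q ^ (n ^ 2)‖ := by
  simpa only [norm_mul, norm_neg_one_zpow, one_mul] using summable_norm_zpow_sq hq

lemma summable_norm_sign_sq_mul_zpow_sq (hq : ‖q‖ < 1) :
    Summable fun n : ℤ => ‖(n : ℂ) ^ 2 * ((-1) ^ n * q ^ (n ^ 2))‖ := by
  simpa only [norm_mul, norm_neg_one_zpow, one_mul] using summable_norm_pow_mul_zpow_sq 2 hq

lemma zpow_sq_add_mul_zpow_sq_sub (hq0 : q ≠ 0) (a b : ℤ) :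
    q ^ ((a + b) ^ 2) * q ^ ((a - b) ^ 2) = (q ^ 2) ^ (a ^ 2) * (q ^ 2) ^ (b ^ 2) := by
  simp only [← zpow_natCast q 2, ← zpow_mul, ← zpow_add₀ hq0]
  congr 1; push_cast; ring

lemma phiC_sq_add_sq (hq0 : q ≠ 0) (hq : ‖q‖ < 1) :
    phiC q ^ 2 + phiC (-q) ^ 2 = 2 * phiC (q ^ 2) ^ 2 := by
  have h1 := summable_norm_zpow_sq hq
  have h2 := summable_norm_sign_mul_zpow_sq hq
  have h3 := summable_norm_zpow_sq (norm_sq_lt_one hq)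
  have := tsum_pair_even fun m n => q ^ (m ^ 2) * q ^ (n ^ 2)
  simp only [zpow_sq_add_mul_zpow_sq_sub hq0] at this
  rw [← tsum_mul_tsum_of_summable_norm h3 h3] at this
  rw [phiC_neg, sq, sq, sq, phiC, phiC, tsum_mul_tsum_of_summable_norm h1 h1,
    tsum_mul_tsum_of_summable_norm h2 h2, ← this,
    ← (summable_mul_of_summable_norm h1 h1).tsum_add (summable_mul_of_summable_norm h2 h2)]
  exact tsum_congr fun p => by ring

lemma sign_mul_zpow_sq_add_mul_zpow_sq_sub (hq0 : q ≠ 0) (a b : ℤ) :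
    (-1) ^ (a - b) * (q ^ ((a + b) ^ 2) * q ^ ((a - b) ^ 2)) =
      ((-1) ^ a * (q ^ 2) ^ (a ^ 2)) * ((-1) ^ b * (q ^ 2) ^ (b ^ 2)) := by
  rw [zpow_sq_add_mul_zpow_sq_sub hq0, zpow_sub₀ (by norm_num), div_eq_mul_inv,
    inv_eq_of_mul_eq_one_right (neg_one_zpow_sq_eq b)]
  ring

lemma phiC_mul_neg (hq0 : q ≠ 0) (hq : ‖q‖ < 1) :
    phiC q * phiC (-q) = phiC (-q ^ 2) ^ 2 := by
  have h1 := summable_norm_zpow_sq hq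
  have h2 := summable_norm_sign_mul_zpow_sq hq
  have h3 := summable_norm_sign_mul_zpow_sq (norm_sq_lt_one hq)
  have := tsum_pair_even fun m n => (-1) ^ n * (q ^ (m ^ 2) * q ^ (n ^ 2))
  simp only [sign_mul_zpow_sq_add_mul_zpow_sq_sub hq0] at this
  rw [← tsum_mul_tsum_of_summable_norm h3 h3] at this
  have hl : ∑' p : ℤ × ℤ, (1 + (-1 : ℂ) ^ p.1 * (-1) ^ p.2) *
      ((-1) ^ p.2 * (q ^ (p.1 ^ 2) * q ^ (p.2 ^ 2))) = phiC q * phiC (-q) + phiC (-q) * phiC q := by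
    rw [phiC_neg, phiC, tsum_mul_tsum_of_summable_norm h1 h2, tsum_mul_tsum_of_summable_norm h2 h1,
      ← (summable_mul_of_summable_norm h1 h2).tsum_add (summable_mul_of_summable_norm h2 h1)]
    refine tsum_congr fun p => ?_
    linear_combination (-1 : ℂ) ^ p.1 * (q ^ (p.1 ^ 2) * q ^ (p.2 ^ 2)) * neg_one_zpow_sq_eq p.2
  rw [hl, ← phiC_neg] at this
  linear_combination this / 2

lemma hasSum_mul_tsum {f g : ℤ → ℂ} (hf : Summable fun n => ‖f n‖) (hg : Summable fun n => ‖g n‖) :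
    HasSum (fun p : ℤ × ℤ => f p.1 * g p.2) ((∑' n, f n) * ∑' n, g n) := by
  rw [tsum_mul_tsum_of_summable_norm hf hg]
  exact (summable_mul_of_summable_norm hf hg).hasSum

lemma phiC_mul_phiDerivC_add (hq0 : q ≠ 0) (hq : ‖q‖ < 1) :
    phiC q * phiDerivC q + phiC (-q) * phiDerivC (-q) =
      4 * (phiC (q ^ 2) * phiDerivC (q ^ 2)) := by
  have h1 := summable_norm_zpow_sq hq
  have h2 := summable_norm_sign_mul_zpow_sq hq
  have h3 := summable_norm_zpow_sq (norm_sq_lt_one hq)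
  have d1 := summable_norm_pow_mul_zpow_sq 2 hq
  have d2 := summable_norm_sign_sq_mul_zpow_sq hq
  have d3 := summable_norm_pow_mul_zpow_sq 2 (norm_sq_lt_one hq)
  have := tsum_pair_even fun m n => ((m : ℂ) ^ 2 + (n : ℂ) ^ 2) * (q ^ (m ^ 2) * q ^ (n ^ 2))
  have hl := (((hasSum_mul_tsum h1 d1).add (hasSum_mul_tsum d1 h1)).add
    ((hasSum_mul_tsum h2 d2).add (hasSum_mul_tsum d2 h2))).tsum_eq
  have hr := (((hasSum_mul_tsum h3 d3).add (hasSum_mul_tsum d3 h3)).mul_left 2).tsum_eq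
  rw [← phiC_neg, ← phiDerivC_neg, ← phiC, ← phiDerivC] at hl
  rw [← phiC, ← phiDerivC] at hr
  rw [show 4 * (phiC (q ^ 2) * phiDerivC (q ^ 2)) = 2 * (phiC (q ^ 2) * phiDerivC (q ^ 2) +
    phiDerivC (q ^ 2) * phiC (q ^ 2)) by ring, ← hr]
  have e1 : ∑' p : ℤ × ℤ, (1 + (-1 : ℂ) ^ p.1 * (-1) ^ p.2) * (((p.1 : ℂ) ^ 2 + (p.2 : ℂ) ^ 2) *
      (q ^ (p.1 ^ 2) * q ^ (p.2 ^ 2))) = 2 * (phiC q * phiDerivC q + phiC (-q) * phiDerivC (-q)) := by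
    rw [show 2 * (phiC q * phiDerivC q + phiC (-q) * phiDerivC (-q)) =
      phiC q * phiDerivC q + phiDerivC q * phiC q +
        (phiC (-q) * phiDerivC (-q) + phiDerivC (-q) * phiC (-q)) by ring, ← hl]
    exact tsum_congr fun p => by ring
  refine mul_left_cancel₀ (two_ne_zero (α := ℂ)) ?_
  rw [← e1, this]
  congr 1
  refine tsum_congr fun p => ?_
  rw [zpow_sq_add_mul_zpow_sq_sub hq0]
  push_cast
  ring

lemma phiC_mul_phiDerivC_neg_add (hq0 : q ≠ 0) (hq : ‖q‖ < 1) :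
    phiC q * phiDerivC (-q) + phiC (-q) * phiDerivC q =
      4 * (phiC (-q ^ 2) * phiDerivC (-q ^ 2)) := by
  have h1 := summable_norm_zpow_sq hq
  have h2 := summable_norm_sign_mul_zpow_sq hq
  have h3 := summable_norm_sign_mul_zpow_sq (norm_sq_lt_one hq)
  have d1 := summable_norm_pow_mul_zpow_sq 2 hq
  have d2 := summable_norm_sign_sq_mul_zpow_sq hq
  have d3 := summable_norm_sign_sq_mul_zpow_sq (norm_sq_lt_one hq)
  have := tsum_pair_even fun m n =>
    ((m : ℂ) ^ 2 + (n : ℂ) ^ 2) * ((-1) ^ n * (q ^ (m ^ 2) * q ^ (n ^ 2)))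
  have hl := (((hasSum_mul_tsum h1 d2).add (hasSum_mul_tsum d1 h2)).add
    ((hasSum_mul_tsum h2 d1).add (hasSum_mul_tsum d2 h1))).tsum_eq
  have hr := (((hasSum_mul_tsum h3 d3).add (hasSum_mul_tsum d3 h3)).mul_left 2).tsum_eq
  rw [← phiC_neg, ← phiDerivC_neg, ← phiC, ← phiDerivC] at hl
  rw [← phiC_neg, ← phiDerivC_neg] at hr
  rw [show 4 * (phiC (-q ^ 2) * phiDerivC (-q ^ 2)) = 2 * (phiC (-q ^ 2) * phiDerivC (-q ^ 2) +
    phiDerivC (-q ^ 2) * phiC (-q ^ 2)) by ring, ← hr]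
  have e1 : ∑' p : ℤ × ℤ, (1 + (-1 : ℂ) ^ p.1 * (-1) ^ p.2) * (((p.1 : ℂ) ^ 2 + (p.2 : ℂ) ^ 2) *
      ((-1) ^ p.2 * (q ^ (p.1 ^ 2) * q ^ (p.2 ^ 2)))) =
      2 * (phiC q * phiDerivC (-q) + phiC (-q) * phiDerivC q) := by
    rw [show 2 * (phiC q * phiDerivC (-q) + phiC (-q) * phiDerivC q) =
      phiC q * phiDerivC (-q) + phiDerivC q * phiC (-q) +
        (phiC (-q) * phiDerivC q + phiDerivC (-q) * phiC q) by ring, ← hl]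
    refine tsum_congr fun p => ?_
    linear_combination (-1 : ℂ) ^ p.1 * ((p.1 : ℂ) ^ 2 + (p.2 : ℂ) ^ 2) *
      (q ^ (p.1 ^ 2) * q ^ (p.2 ^ 2)) * neg_one_zpow_sq_eq p.2
  refine mul_left_cancel₀ (two_ne_zero (α := ℂ)) ?_
  rw [← e1, this]
  congr 1
  refine tsum_congr fun p => ?_
  rw [sign_mul_zpow_sq_add_mul_zpow_sq_sub hq0]
  push_cast
  ring

lemma phiC_sq_sub_sq (hq0 : q ≠ 0) (hq : ‖q‖ < 1) :
    phiC q ^ 2 - phiC (-q) ^ 2 = 2 * q * psiBilateralC (q ^ 2) ^ 2 := by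
  have h1 := summable_norm_zpow_sq hq
  have h2 := summable_norm_sign_mul_zpow_sq hq
  have h3 := summable_norm_zpow_mul_succ (norm_sq_lt_one hq)
  have := tsum_pair_odd fun m n => q ^ (m ^ 2) * q ^ (n ^ 2)
  have hterm (a b : ℤ) : q ^ ((a + b + 1) ^ 2) * q ^ ((a - b) ^ 2) =
      q * ((q ^ 2) ^ (a * (a + 1)) * (q ^ 2) ^ (b * (b + 1))) := by
    nth_rw 3 [← zpow_one q]
    simp only [← zpow_natCast q 2, ← zpow_mul, ← zpow_add₀ hq0]
    congr 1; push_cast; ring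
  simp only [hterm] at this
  rw [tsum_mul_left, ← tsum_mul_tsum_of_summable_norm h3 h3, ← psiBilateralC] at this
  rw [mul_assoc, sq (psiBilateralC _), ← this, phiC_neg, sq, sq, phiC]
  rw [← ((hasSum_mul_tsum h1 h1).sub (hasSum_mul_tsum h2 h2)).tsum_eq]
  exact tsum_congr fun p => by ring

lemma psiBilateralC_sq (hq0 : q ≠ 0) (hq : ‖q‖ < 1) :
    psiBilateralC q ^ 2 = 2 * (phiC (q ^ 2) * psiBilateralC (q ^ 2)) := by
  have h1 := summable_norm_zpow_mul_succ hq
  have h2 := summable_norm_zpow_mul_succ (norm_sq_lt_one hq)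
  have h3 := summable_norm_zpow_sq (norm_sq_lt_one hq)
  have hs := summable_mul_of_summable_norm h1 h1
  have he := tsum_pair_even fun m n => q ^ (m * (m + 1)) * q ^ (n * (n + 1))
  have ho := tsum_pair_odd fun m n => q ^ (m * (m + 1)) * q ^ (n * (n + 1))
  have hte (a b : ℤ) : q ^ ((a + b) * (a + b + 1)) * q ^ ((a - b) * (a - b + 1)) =
      (q ^ 2) ^ (a * (a + 1)) * (q ^ 2) ^ (b ^ 2) := by
    simp only [← zpow_natCast q 2, ← zpow_mul, ← zpow_add₀ hq0]
    congr 1; push_cast; ring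
  have hto (a b : ℤ) : q ^ ((a + b + 1) * (a + b + 1 + 1)) * q ^ ((a - b) * (a - b + 1)) =
      (q ^ 2) ^ ((a + 1) ^ 2) * (q ^ 2) ^ (b * (b + 1)) := by
    simp only [← zpow_natCast q 2, ← zpow_mul, ← zpow_add₀ hq0]
    congr 1; push_cast; ring
  have h3' : Summable fun n : ℤ => ‖(q ^ 2) ^ ((n + 1) ^ 2)‖ :=
    h3.comp_injective (add_left_injective (1 : ℤ))
  have hshift : ∑' n : ℤ, (q ^ 2) ^ ((n + 1) ^ 2) = phiC (q ^ 2) :=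
    (Equiv.addRight (1 : ℤ)).tsum_eq fun n => (q ^ 2) ^ (n ^ 2)
  simp only [hte, hto] at he ho
  rw [← tsum_mul_tsum_of_summable_norm h2 h3, ← psiBilateralC, ← phiC] at he
  rw [← tsum_mul_tsum_of_summable_norm h3' h2, ← psiBilateralC, hshift] at ho
  have hsign : Summable fun p : ℤ × ℤ => ((-1 : ℂ) ^ p.1 * (-1) ^ p.2) *
      (q ^ (p.1 * (p.1 + 1)) * q ^ (p.2 * (p.2 + 1))) := by
    refine Summable.of_norm ?_
    simp only [norm_mul, norm_neg_one_zpow, one_mul]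
    simpa only [norm_mul] using h1.mul_norm h1
  simp only [add_mul, sub_mul, one_mul] at he ho
  rw [hs.tsum_add hsign] at he
  rw [hs.tsum_sub hsign] at ho
  rw [← tsum_mul_tsum_of_summable_norm h1 h1, ← psiBilateralC] at he ho
  linear_combination (he + ho) / 2

end Quadratic

/-! ### The series `Σ zⁿ / (qⁿ + q⁻ⁿ)` -/

/-- The coefficient `1 / (qⁿ + q⁻ⁿ)`, in a form that is also meaningful at `q = 0`. -/
noncomputable def sechC (q : ℂ) (n : ℤ) : ℂ := q ^ n.natAbs / (1 + q ^ (2 * n.natAbs))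

/-- The series `Σ_{n ∈ ℤ} 1 / (qⁿ + q⁻ⁿ)`. -/
noncomputable def sechSum (q : ℂ) : ℂ := ∑' n : ℤ, sechC q n

section Sech

variable {q : ℂ}

lemma one_sub_norm_le_norm_one_add_pow (hq : ‖q‖ < 1) (k : ℕ) :
    1 - ‖q‖ ≤ ‖1 + q ^ (2 * k)‖ := by
  rcases Nat.eq_zero_or_pos k with rfl | hk
  · norm_num
    linarith [norm_nonneg q]
  · have h1 : ‖q ^ (2 * k)‖ ≤ ‖q‖ := by
      rw [norm_pow]
      exact pow_le_of_le_one (norm_nonneg _) hq.le (by omega)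
    have h2 := norm_sub_le (1 + q ^ (2 * k)) (q ^ (2 * k))
    simp only [add_sub_cancel_right, norm_one] at h2
    linarith

lemma one_add_pow_ne_zero (hq : ‖q‖ < 1) (k : ℕ) : 1 + q ^ (2 * k) ≠ 0 :=
  norm_pos_iff.mp ((sub_pos.mpr hq).trans_le (one_sub_norm_le_norm_one_add_pow hq k))

lemma norm_sechC_le (hq : ‖q‖ < 1) (n : ℤ) :
    ‖sechC q n‖ ≤ ‖q‖ ^ n.natAbs * (1 - ‖q‖)⁻¹ := by
  rw [sechC, norm_div, norm_pow, div_eq_mul_inv]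
  have := sub_pos.mpr hq
  gcongr
  exact one_sub_norm_le_norm_one_add_pow hq _

lemma summable_norm_pow_mul_sechC (k : ℕ) (hq : ‖q‖ < 1) :
    Summable fun n : ℤ => ‖(n : ℂ) ^ k * sechC q n‖ := by
  refine Summable.of_nonneg_of_le (fun _ => norm_nonneg _) (fun n => ?_)
    ((summable_natAbs_pow_mul_geometric k (norm_nonneg q) hq).mul_right (1 - ‖q‖)⁻¹)
  rw [norm_mul, norm_pow, norm_intCast_eq_natAbs, mul_assoc]
  gcongr
  exact norm_sechC_le hq n

lemma summable_norm_sechC (hq : ‖q‖ < 1) : Summable fun n : ℤ => ‖sechC q n‖ := by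
  simpa using summable_norm_pow_mul_sechC 0 hq

lemma sechC_mul (hq0 : q ≠ 0) (hq : ‖q‖ < 1) (n : ℤ) :
    sechC q n * (q ^ n + q ^ (-n)) = 1 := by
  obtain ⟨k, rfl | rfl⟩ := n.eq_nat_or_neg
  all_goals
    have := one_add_pow_ne_zero hq k
    simp only [sechC, Int.natAbs_neg, Int.natAbs_natCast, neg_neg, zpow_neg, zpow_natCast]
    rw [mul_comm 2 k, pow_mul] at *
    field_simp
  ring

lemma sechC_neg_arg (q : ℂ) (n : ℤ) : sechC (-q) n = (-1) ^ n * sechC q n := by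
  obtain ⟨k, rfl | rfl⟩ := n.eq_nat_or_neg
  all_goals
    simp only [sechC, Int.natAbs_neg, Int.natAbs_natCast, zpow_neg, zpow_natCast,
      (even_two_mul k).neg_pow]
    rw [neg_pow q k, mul_div_assoc]
  rw [← inv_pow]
  norm_num

lemma sechC_neg (q : ℂ) (n : ℤ) : sechC q (-n) = sechC q n := by
  simp [sechC]

lemma sechC_sq_arg (q : ℂ) (n : ℤ) : sechC (q ^ 2) n = sechC q (2 * n) := by
  simp only [sechC, Int.natAbs_mul, ← pow_mul]
  norm_num

lemma sechSum_add_neg (hq : ‖q‖ < 1) : sechSum q + sechSum (-q) = 2 * sechSum (q ^ 2) := by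
  have h := (summable_norm_sechC hq).of_norm
  have h' : Summable fun n => sechC (-q) n :=
    (summable_norm_sechC (q := -q) (by rwa [norm_neg])).of_norm
  have hinj : Function.Injective fun n : ℤ => 2 * n := fun a b hab => by
    simpa using hab
  rw [sechSum, sechSum, sechSum, ← h.tsum_add h', ← hinj.tsum_eq, ← tsum_mul_left]
  · refine tsum_congr fun n => ?_
    rw [sechC_neg_arg, sechC_sq_arg, (even_two_mul n).neg_one_zpow]
    ring
  · intro n hn
    rcases Int.even_or_odd n with ⟨k, hk⟩ | h
    · exact ⟨k, by simp only; omega⟩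
    · refine absurd ?_ hn
      simp [sechC_neg_arg, h.neg_one_zpow]

/-- The Fourier coefficients of the product of `Σ zⁿ / (qⁿ + q⁻ⁿ)` and `Σ (-1)ⁿ q^{n²} zⁿ`. -/
noncomputable def sechConv (q : ℂ) (N : ℤ) : ℂ :=
  ∑' n : ℤ, sechC q n * ((-1) ^ (N - n) * q ^ ((N - n) ^ 2))

lemma summable_norm_sechConv (hq : ‖q‖ < 1) (N : ℤ) :
    Summable fun n : ℤ => ‖sechC q n * ((-1) ^ (N - n) * q ^ ((N - n) ^ 2))‖ := by
  refine Summable.of_nonneg_of_le (fun _ => norm_nonneg _) (fun n => ?_) (summable_norm_sechC hq)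
  rw [norm_mul, norm_mul, norm_neg_one_zpow, one_mul]
  refine mul_le_of_le_one_right (norm_nonneg _) ((norm_zpow_sq_le hq _).trans ?_)
  exact pow_le_one₀ (norm_nonneg _) hq.le

lemma tsum_sign_mul_zpow_eq_zero (q : ℂ) (N : ℤ) :
    ∑' n : ℤ, (-1 : ℂ) ^ (N + 1 - n) * q ^ ((N + 1 - n) ^ 2 + n) = 0 := by
  have h := (Equiv.subLeft (2 * N + 1)).tsum_eq
    fun n : ℤ => (-1 : ℂ) ^ (N + 1 - n) * q ^ ((N + 1 - n) ^ 2 + n)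
  have h' : ∀ n : ℤ, (-1 : ℂ) ^ (N + 1 - Equiv.subLeft (2 * N + 1) n) *
      q ^ ((N + 1 - Equiv.subLeft (2 * N + 1) n) ^ 2 + Equiv.subLeft (2 * N + 1) n) =
      -((-1 : ℂ) ^ (N + 1 - n) * q ^ ((N + 1 - n) ^ 2 + n)) := by
    intro n
    simp only [Equiv.subLeft_apply]
    rw [show (N + 1 - (2 * N + 1 - n)) ^ 2 + (2 * N + 1 - n) = (N + 1 - n) ^ 2 + n by ring,
      show N + 1 - (2 * N + 1 - n) = (N + 1 - n) + (2 * n - 2 * N - 1) by ring,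
      zpow_add₀ (by norm_num), Odd.neg_one_zpow (n := 2 * n - 2 * N - 1) ⟨n - N - 1, by ring⟩]
    ring
  simp only [h', tsum_neg] at h
  exact self_eq_neg.mp h.symm

lemma sechConv_succ (hq0 : q ≠ 0) (hq : ‖q‖ < 1) (N : ℤ) :
    sechConv q (N + 1) = q ^ (2 * N + 1) * sechConv q N := by
  rw [← sub_eq_zero, sechConv, sechConv, ← tsum_mul_left,
    ← (summable_norm_sechConv hq (N + 1)).of_norm.tsum_sub
      ((summable_norm_sechConv hq N).of_norm.mul_left _), ← tsum_sign_mul_zpow_eq_zero q N]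
  refine tsum_congr fun n => ?_
  have h1 : (-1 : ℂ) ^ (N + 1 - n) = -(-1) ^ (N - n) := by
    rw [show N + 1 - n = (N - n) + 1 by ring, zpow_add_one₀ (by norm_num)]
    ring
  have h2 : q ^ ((N + 1 - n) ^ 2) = q ^ ((N + 1 - n) ^ 2 + n) * q ^ (-n) := by
    rw [← zpow_add₀ hq0]; congr 1; ring
  have h3 : q ^ (2 * N + 1) * q ^ ((N - n) ^ 2) = q ^ ((N + 1 - n) ^ 2 + n) * q ^ n := by
    rw [← zpow_add₀ hq0, ← zpow_add₀ hq0]; congr 1; ring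
  have h4 := sechC_mul hq0 hq n
  rw [h1, h2]
  linear_combination (-sechC q n * (-1) ^ (N - n)) * h3 -
    (-1) ^ (N - n) * q ^ ((N + 1 - n) ^ 2 + n) * h4

lemma sechConv_eq (hq0 : q ≠ 0) (hq : ‖q‖ < 1) (N : ℤ) :
    sechConv q N = q ^ (N ^ 2) * sechConv q 0 := by
  induction N with
  | zero => simp
  | succ k ih =>
    rw [sechConv_succ hq0 hq, ih, ← mul_assoc, ← zpow_add₀ hq0]
    congr 2; ring
  | pred k ih =>
    have h := sechConv_succ hq0 hq (-(k : ℤ) - 1)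
    rw [sub_add_cancel, ih] at h
    refine mul_left_cancel₀ (zpow_ne_zero (2 * (-(k : ℤ) - 1) + 1) hq0) ?_
    rw [← h, ← mul_assoc, ← zpow_add₀ hq0]
    congr 2; ring

/-- Weighted form of the factorization `D(z) θ(-q, z) = c · θ(q, z)`. -/
lemma tsum_sechC_mul_weight (hq0 : q ≠ 0) (hq : ‖q‖ < 1) (W : ℤ → ℂ)
    (hW : Summable fun p : ℤ × ℤ =>
      W (p.1 + p.2) * (sechC q p.1 * ((-1) ^ p.2 * q ^ (p.2 ^ 2)))) :
    ∑' p : ℤ × ℤ, W (p.1 + p.2) * (sechC q p.1 * ((-1) ^ p.2 * q ^ (p.2 ^ 2))) =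
      sechConv q 0 * ∑' N : ℤ, W N * q ^ (N ^ 2) := by
  let e : ℤ × ℤ ≃ ℤ × ℤ :=
    { toFun := fun p => (p.2, p.1 - p.2)
      invFun := fun p => (p.1 + p.2, p.1)
      left_inv := fun p => by simp
      right_inv := fun p => by simp }
  rw [← e.tsum_eq]
  refine (e.summable_iff.mpr hW).tsum_prod.trans ?_
  rw [← tsum_mul_left]
  refine tsum_congr fun N => ?_
  calc _ = ∑' n : ℤ, W N * (sechC q n * ((-1) ^ (N - n) * q ^ ((N - n) ^ 2))) :=
        tsum_congr fun n => by simp [e]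
    _ = _ := by rw [tsum_mul_left, ← sechConv, sechConv_eq hq0 hq]; ring

lemma sechSum_mul_phiC_neg (hq0 : q ≠ 0) (hq : ‖q‖ < 1) :
    sechSum q * phiC (-q) = sechConv q 0 * phiC q := by
  have h := hasSum_mul_tsum (summable_norm_sechC hq) (summable_norm_sign_mul_zpow_sq hq)
  rw [← phiC_neg, ← sechSum] at h
  have := tsum_sechC_mul_weight hq0 hq (fun _ => 1) (by simpa using h.summable)
  simp only [one_mul] at this
  rw [← h.tsum_eq, this, phiC]

lemma sechSum_neg_mul_phiC (hq0 : q ≠ 0) (hq : ‖q‖ < 1) :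
    sechSum (-q) * phiC q = sechConv q 0 * phiC (-q) := by
  have hq' : ‖-q‖ < 1 := by rwa [norm_neg]
  have h := hasSum_mul_tsum (summable_norm_sechC hq') (summable_norm_zpow_sq hq)
  rw [← phiC, ← sechSum] at h
  have e : (fun p : ℤ × ℤ => sechC (-q) p.1 * q ^ (p.2 ^ 2)) = fun p =>
      (-1) ^ (p.1 + p.2) * (sechC q p.1 * ((-1) ^ p.2 * q ^ (p.2 ^ 2))) := by
    ext p
    rw [sechC_neg_arg, zpow_add₀ (by norm_num)]
    linear_combination (-(-1) ^ p.1 * sechC q p.1 * q ^ (p.2 ^ 2)) * neg_one_zpow_sq_eq p.2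
  rw [e] at h
  rw [← h.tsum_eq, tsum_sechC_mul_weight hq0 hq (fun n => (-1) ^ n) h.summable, ← phiC_neg]

/-- The series `Σ_{n ∈ ℤ} n² / (qⁿ + q⁻ⁿ)`. -/
noncomputable def sechSqSum (q : ℂ) : ℂ := ∑' n : ℤ, (n : ℂ) ^ 2 * sechC q n

lemma tsum_int_mul_sechC (q : ℂ) : ∑' n : ℤ, (n : ℂ) ^ 1 * sechC q n = 0 := by
  have h := (Equiv.neg ℤ).tsum_eq fun n : ℤ => (n : ℂ) ^ 1 * sechC q n
  simp only [Equiv.neg_apply, sechC_neg, Int.cast_neg, pow_one, neg_mul, tsum_neg] at h ⊢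
  exact self_eq_neg.mp h.symm

lemma sechSqSum_mul_phiC_neg (hq0 : q ≠ 0) (hq : ‖q‖ < 1) :
    sechSqSum q * phiC (-q) + sechSum q * phiDerivC (-q) = sechConv q 0 * phiDerivC q := by
  have d1 : Summable fun n : ℤ => ‖(n : ℂ) ^ 1 * ((-1) ^ n * q ^ (n ^ 2))‖ := by
    simpa only [norm_mul, norm_neg_one_zpow, one_mul] using summable_norm_pow_mul_zpow_sq 1 hq
  have h0 := hasSum_mul_tsum (summable_norm_sechC hq) (summable_norm_sign_sq_mul_zpow_sq hq)
  have h1 := hasSum_mul_tsum (summable_norm_pow_mul_sechC 1 hq) d1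
  have h2 := hasSum_mul_tsum (summable_norm_pow_mul_sechC 2 hq) (summable_norm_sign_mul_zpow_sq hq)
  rw [← phiDerivC_neg, ← sechSum] at h0
  rw [tsum_int_mul_sechC, zero_mul] at h1
  rw [← phiC_neg, ← sechSqSum] at h2
  have h := (h2.add h0).add (h1.mul_left 2)
  rw [mul_zero, add_zero] at h
  have e : (fun p : ℤ × ℤ => ((p.1 : ℂ) ^ 2 * sechC q p.1) * ((-1) ^ p.2 * q ^ (p.2 ^ 2)) +
      sechC q p.1 * ((p.2 : ℂ) ^ 2 * ((-1) ^ p.2 * q ^ (p.2 ^ 2))) +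
      2 * (((p.1 : ℂ) ^ 1 * sechC q p.1) * ((p.2 : ℂ) ^ 1 * ((-1) ^ p.2 * q ^ (p.2 ^ 2))))) =
      fun p => (((p.1 + p.2 : ℤ) : ℂ) ^ 2) * (sechC q p.1 * ((-1) ^ p.2 * q ^ (p.2 ^ 2))) := by
    ext p
    push_cast
    ring
  rw [e] at h
  rw [← h.tsum_eq, tsum_sechC_mul_weight hq0 hq (fun n => (n : ℂ) ^ 2) h.summable, phiDerivC]

end Sech

/-! ### Behaviour near `q = 0` and invariance under `q ↦ q²` -/

section Limit

variable {q : ℂ}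

lemma tendsto_pow_two_pow (hq0 : q ≠ 0) (hq : ‖q‖ < 1) :
    Tendsto (fun k : ℕ => q ^ 2 ^ k) atTop (𝓝[≠] 0) := by
  refine tendsto_nhdsWithin_iff.mpr ⟨?_, .of_forall fun k => pow_ne_zero _ hq0⟩
  exact (tendsto_pow_atTop_nhds_zero_of_norm_lt_one hq).comp
    (tendsto_pow_atTop_atTop_of_one_lt one_lt_two)

lemma norm_pow_two_pow_lt_one (hq : ‖q‖ < 1) (k : ℕ) : ‖q ^ 2 ^ k‖ < 1 := by
  rw [norm_pow]
  exact pow_lt_one₀ (norm_nonneg _) hq (by positivity)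

/-- A function on the punctured unit disc whose zeros are stable under squaring and which has a
nonzero limit at `0` does not vanish. -/
lemma ne_zero_of_sq_stable {h : ℂ → ℂ} {c : ℂ} (hc : c ≠ 0)
    (hst : ∀ q : ℂ, q ≠ 0 → ‖q‖ < 1 → h q = 0 → h (q ^ 2) = 0)
    (hlim : Tendsto h (𝓝[≠] 0) (𝓝 c)) (hq0 : q ≠ 0) (hq : ‖q‖ < 1) : h q ≠ 0 := by
  intro h0
  have hpow (k : ℕ) : h (q ^ 2 ^ k) = 0 := by
    induction k with
    | zero => simpa using h0
    | succ k ih =>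
      rw [pow_succ, pow_mul]
      exact hst _ (pow_ne_zero _ hq0) (norm_pow_two_pow_lt_one hq k) ih
  have := hlim.comp (tendsto_pow_two_pow hq0 hq)
  simp only [Function.comp_def, hpow] at this
  exact hc (tendsto_nhds_unique tendsto_const_nhds this).symm

/-- A function on the punctured unit disc which is invariant under squaring and has a limit at `0`
is constant. -/
lemma eq_of_sq_invariant {h : ℂ → ℂ} {c : ℂ}
    (hinv : ∀ q : ℂ, q ≠ 0 → ‖q‖ < 1 → h (q ^ 2) = h q) (hlim : Tendsto h (𝓝[≠] 0) (𝓝 c))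
    (hq0 : q ≠ 0) (hq : ‖q‖ < 1) : h q = c := by
  have hpow (k : ℕ) : h (q ^ 2 ^ k) = h q := by
    induction k with
    | zero => simp
    | succ k ih =>
      rw [pow_succ, pow_mul, hinv _ (pow_ne_zero _ hq0) (norm_pow_two_pow_lt_one hq k), ih]
  have := hlim.comp (tendsto_pow_two_pow hq0 hq)
  simp only [Function.comp_def, hpow] at this
  exact tendsto_nhds_unique tendsto_const_nhds this

/-- Dominated passage to the limit `q → 0` in a series. -/
lemma tendsto_tsum_zero {t : ℂ → ℤ → ℂ} {l : ℤ → ℂ} {bound : ℤ → ℝ} (hb : Summable bound)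
    (ht : ∀ n, Tendsto (fun q => t q n) (𝓝[≠] 0) (𝓝 (l n)))
    (hle : ∀ q : ℂ, q ≠ 0 → ‖q‖ ≤ 1 / 2 → ∀ n, ‖t q n‖ ≤ bound n) :
    Tendsto (fun q => ∑' n, t q n) (𝓝[≠] 0) (𝓝 (∑' n, l n)) := by
  refine tendsto_tsum_of_dominated_convergence hb ht ?_
  have h1 : ∀ᶠ q : ℂ in 𝓝[≠] 0, ‖q‖ ≤ 1 / 2 := by
    refine Filter.Eventually.filter_mono nhdsWithin_le_nhds ?_
    filter_upwards [Metric.closedBall_mem_nhds (0 : ℂ) (show (0 : ℝ) < 1 / 2 by norm_num)]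
      with q hq using by simpa using hq
  filter_upwards [h1, self_mem_nhdsWithin] with q hq hq0 using hle q hq0 hq

lemma tendsto_phiC : Tendsto phiC (𝓝[≠] 0) (𝓝 1) := by
  have h := tendsto_tsum_zero (t := fun q n => q ^ (n ^ 2)) (l := fun n => (0 : ℂ) ^ (n.natAbs ^ 2))
    (summable_natAbs_pow_mul_geometric 0 (by norm_num : (0 : ℝ) ≤ 1 / 2) (by norm_num))
    (fun n => by
      simp only [zpow_sq_eq_pow_natAbs]
      exact ((continuous_pow _).tendsto 0).mono_left nhdsWithin_le_nhds)
    (fun q hq0 hq n => by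
      rw [pow_zero, one_mul]
      refine (norm_zpow_sq_le (by linarith) n).trans ?_
      gcongr)
  rwa [tsum_eq_single 0 (fun n hn => by simp [hn])] at h

lemma tendsto_neg_punctured : Tendsto (fun q : ℂ => -q) (𝓝[≠] 0) (𝓝[≠] 0) := by
  refine tendsto_nhdsWithin_iff.mpr ⟨?_, ?_⟩
  · exact (continuous_neg.tendsto' 0 0 neg_zero).mono_left nhdsWithin_le_nhds
  · filter_upwards [self_mem_nhdsWithin] with q hq using neg_ne_zero.mpr hq

lemma tendsto_phiC_neg : Tendsto (fun q => phiC (-q)) (𝓝[≠] 0) (𝓝 1) :=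
  tendsto_phiC.comp tendsto_neg_punctured

lemma tendsto_sechSum : Tendsto sechSum (𝓝[≠] 0) (𝓝 (1 / 2)) := by
  have h := tendsto_tsum_zero (t := sechC) (l := sechC 0)
    ((summable_natAbs_pow_mul_geometric 0 (by norm_num : (0 : ℝ) ≤ 1 / 2) (by norm_num)).mul_right 2)
    (fun n => by
      refine Tendsto.mono_left ?_ nhdsWithin_le_nhds
      refine ((continuous_pow n.natAbs).tendsto 0).div
        (((continuous_pow (2 * n.natAbs)).tendsto 0).const_add 1) ?_
      exact one_add_pow_ne_zero (by simp) _)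
    (fun q hq0 hq n => by
      rw [pow_zero, one_mul]
      refine (norm_sechC_le (by linarith) n).trans ?_
      have h1 : (1 - ‖q‖)⁻¹ ≤ 2 := by
        rw [inv_le_comm₀ (by linarith) (by norm_num)]
        linarith
      have h2 : 0 ≤ (1 - ‖q‖)⁻¹ := inv_nonneg.mpr (by linarith)
      gcongr)
  rw [tsum_eq_single 0 (fun n hn => by simp [sechC, hn])] at h
  have h2 : sechC 0 0 = 1 / 2 := by norm_num [sechC]
  rwa [h2] at h

lemma tendsto_psiBilateralC : Tendsto psiBilateralC (𝓝[≠] 0) (𝓝 2) := by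
  have h := tendsto_tsum_zero (t := fun q n => q ^ (n * (n + 1)))
    (l := fun n => (0 : ℂ) ^ (n * (n + 1)).toNat)
    (summable_norm_zpow_mul_succ (q := 1 / 2) (by norm_num))
    (fun n => by
      have (q : ℂ) : q ^ (n * (n + 1)) = q ^ (n * (n + 1)).toNat := by
        rw [← zpow_natCast, Int.toNat_of_nonneg (by rcases le_or_gt 0 n with h | h <;> nlinarith)]
      simp only [this]
      exact ((continuous_pow _).tendsto 0).mono_left nhdsWithin_le_nhds)
    (fun q hq0 hq n => by
      rw [norm_zpow, norm_zpow]
      refine zpow_le_zpow_left₀ (by rcases le_or_gt 0 n with h | h <;> nlinarith)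
        (norm_nonneg _) (hq.trans (by norm_num)))
  rw [tsum_eq_sum (s := {0, -1}) (fun n hn => by
    simp only [Finset.mem_insert, Finset.mem_singleton, not_or] at hn
    refine zero_pow ?_
    have : 0 < n * (n + 1) := by
      rcases lt_or_gt_of_ne hn.1 with h | h
      · have : n + 1 < 0 := by omega
        nlinarith
      · nlinarith
    omega)] at h
  have h2 : ∑ n ∈ ({0, -1} : Finset ℤ), (0 : ℂ) ^ (n * (n + 1)).toNat = 2 := by norm_num
  rwa [h2] at h

lemma tendsto_phiDerivC_div : Tendsto (fun q => phiDerivC q / q) (𝓝[≠] 0) (𝓝 2) := by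
  have hterm (q : ℂ) (hq0 : q ≠ 0) (n : ℤ) :
      (n : ℂ) ^ 2 * q ^ (n ^ 2) / q = (n : ℂ) ^ 2 * q ^ (n.natAbs ^ 2 - 1) := by
    rcases eq_or_ne n 0 with rfl | hn
    · simp
    · have : 1 ≤ n.natAbs ^ 2 := Nat.one_le_pow _ _ (Int.natAbs_pos.mpr hn)
      rw [zpow_sq_eq_pow_natAbs, mul_div_assoc, pow_sub₀ q hq0 this, pow_one, div_eq_mul_inv]
  have h := tendsto_tsum_zero (t := fun q n => (n : ℂ) ^ 2 * q ^ (n.natAbs ^ 2 - 1))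
    (l := fun n => (n : ℂ) ^ 2 * 0 ^ (n.natAbs ^ 2 - 1))
    ((summable_natAbs_pow_mul_geometric 2 (by norm_num : (0 : ℝ) ≤ 1 / 2) (by norm_num)).mul_right 2)
    (fun n => (((continuous_pow _).tendsto 0).mono_left nhdsWithin_le_nhds).const_mul _)
    (fun q hq0 hq n => by
      rcases eq_or_ne n 0 with rfl | hn
      · simp
      rw [norm_mul, norm_pow, norm_pow, norm_intCast_eq_natAbs, mul_assoc]
      gcongr
      have h1 : 1 ≤ n.natAbs := Int.natAbs_pos.mpr hn
      have h2 : n.natAbs - 1 ≤ n.natAbs ^ 2 - 1 :=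
        Nat.sub_le_sub_right (Nat.le_self_pow two_ne_zero _) 1
      calc ‖q‖ ^ (n.natAbs ^ 2 - 1) ≤ (1 / 2) ^ (n.natAbs ^ 2 - 1) := by gcongr
        _ ≤ (1 / 2) ^ (n.natAbs - 1) :=
          pow_le_pow_of_le_one (by norm_num) (by norm_num) h2
        _ = (1 / 2) ^ n.natAbs * 2 := by
          obtain ⟨k, hk⟩ := Nat.exists_eq_add_of_le' h1
          rw [hk, Nat.add_sub_cancel, pow_succ]; ring)
  rw [tsum_eq_sum (s := {1, -1}) (fun n hn => by
    simp only [Finset.mem_insert, Finset.mem_singleton, not_or] at hn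
    rcases eq_or_ne n 0 with rfl | hn0
    · simp
    have : 2 ≤ n.natAbs := by omega
    rw [zero_pow, mul_zero]
    have := Nat.pow_le_pow_left this 2
    omega)] at h
  norm_num at h
  refine h.congr' ?_
  filter_upwards [self_mem_nhdsWithin] with q hq0
  rw [phiDerivC, ← tsum_div_const]
  exact tsum_congr fun n => (hterm q hq0 n).symm

lemma tendsto_phiDerivC_neg_div : Tendsto (fun q => phiDerivC (-q) / q) (𝓝[≠] 0) (𝓝 (-2)) := by
  refine (tendsto_phiDerivC_div.comp tendsto_neg_punctured).neg.congr fun q => ?_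
  simp [div_neg]

lemma phiC_neg_ne_zero (hq0 : q ≠ 0) (hq : ‖q‖ < 1) : phiC (-q) ≠ 0 := by
  refine ne_zero_of_sq_stable (h := fun q => phiC (-q)) one_ne_zero (fun z hz0 hz h => ?_)
    tendsto_phiC_neg hq0 hq
  have := phiC_mul_neg hz0 hz
  rw [h, mul_zero] at this
  exact pow_eq_zero_iff two_ne_zero |>.mp this.symm

lemma phiC_ne_zero (hq0 : q ≠ 0) (hq : ‖q‖ < 1) : phiC q ≠ 0 := by
  simpa using phiC_neg_ne_zero (q := -q) (neg_ne_zero.mpr hq0) (by rwa [norm_neg])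

lemma psiBilateralC_ne_zero (hq0 : q ≠ 0) (hq : ‖q‖ < 1) : psiBilateralC q ≠ 0 := by
  refine ne_zero_of_sq_stable two_ne_zero (fun z hz0 hz h => ?_) tendsto_psiBilateralC hq0 hq
  have := psiBilateralC_sq hz0 hz
  rw [h] at this
  simpa [phiC_ne_zero (pow_ne_zero 2 hz0) (norm_sq_lt_one hz)] using this

/-- Jacobi's two-square theorem: `φ(q)² = 2 Σ 1 / (qⁿ + q⁻ⁿ)`. -/
lemma two_mul_sechSum (hq0 : q ≠ 0) (hq : ‖q‖ < 1) : 2 * sechSum q = phiC q ^ 2 := by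
  have hlim : Tendsto (fun q => sechSum q / phiC q ^ 2) (𝓝[≠] 0) (𝓝 (1 / 2)) := by
    have := tendsto_sechSum.div (tendsto_phiC.pow 2) (by norm_num)
    rwa [one_pow, div_one] at this
  have h := eq_of_sq_invariant (fun z hz0 hz => ?_) hlim hq0 hq
  · have := phiC_ne_zero hq0 hq
    field_simp at h
    linear_combination h
  · have hf := phiC_ne_zero hz0 hz
    have hg := phiC_neg_ne_zero hz0 hz
    have hF := phiC_ne_zero (pow_ne_zero 2 hz0) (norm_sq_lt_one hz)
    have e1 := sechSum_mul_phiC_neg hz0 hz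
    have e2 := sechSum_neg_mul_phiC hz0 hz
    have e3 := sechSum_add_neg hz
    have e4 := phiC_sq_add_sq hz0 hz
    rw [div_eq_div_iff (pow_ne_zero 2 hF) (pow_ne_zero 2 hf)]
    have e5 : sechSum (-z) * phiC z ^ 2 = sechSum z * phiC (-z) ^ 2 := by
      linear_combination phiC z * e2 - phiC (-z) * e1
    refine mul_left_cancel₀ (two_ne_zero (α := ℂ)) ?_
    linear_combination -phiC z ^ 2 * e3 + sechSum z * e4 + e5

/-- The logarithmic derivative of `φ(q) / φ(-q)` in terms of fourth powers. -/
lemma phiDerivC_wronskian (hq0 : q ≠ 0) (hq : ‖q‖ < 1) :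
    4 * (phiDerivC q * phiC (-q) - phiDerivC (-q) * phiC q) =
      phiC q * phiC (-q) * (q * psiBilateralC q ^ 4) := by
  have hlim : Tendsto (fun q => (phiDerivC q / q * phiC (-q) - phiDerivC (-q) / q * phiC q) /
      (phiC q * phiC (-q) * psiBilateralC q ^ 4)) (𝓝[≠] 0) (𝓝 (1 / 4)) := by
    have := ((tendsto_phiDerivC_div.mul tendsto_phiC_neg).sub
      (tendsto_phiDerivC_neg_div.mul tendsto_phiC)).div
      ((tendsto_phiC.mul tendsto_phiC_neg).mul (tendsto_psiBilateralC.pow 4)) (by norm_num)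
    rwa [show ((2 * 1 - -2 * 1) / (1 * 1 * 2 ^ 4) : ℂ) = 1 / 4 by norm_num] at this
  have h := eq_of_sq_invariant (fun z hz0 hz => ?_) hlim hq0 hq
  · have := phiC_ne_zero hq0 hq
    have := phiC_neg_ne_zero hq0 hq
    have := psiBilateralC_ne_zero hq0 hq
    field_simp at h
    linear_combination h
  · have hz20 := pow_ne_zero 2 hz0
    have hz2 := norm_sq_lt_one hz
    have hf := phiC_ne_zero hz0 hz
    have hg := phiC_neg_ne_zero hz0 hz
    have hF := phiC_ne_zero hz20 hz2
    have hG := phiC_neg_ne_zero hz20 hz2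
    have hp := psiBilateralC_ne_zero hz0 hz
    have hP := psiBilateralC_ne_zero hz20 hz2
    have e1 := phiC_sq_add_sq hz0 hz
    have e2 := phiC_mul_neg hz0 hz
    have e3 := phiC_mul_phiDerivC_add hz0 hz
    have e4 := phiC_mul_phiDerivC_neg_add hz0 hz
    have e5 := phiC_sq_sub_sq hz0 hz
    have e6 := psiBilateralC_sq hz0 hz
    generalize phiC z = f at *
    generalize phiC (-z) = g at *
    generalize phiC (z ^ 2) = F at *
    generalize phiC (-z ^ 2) = G at *
    generalize phiDerivC z = X at *
    generalize phiDerivC (-z) = Y at *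
    generalize phiDerivC (z ^ 2) = X' at *
    generalize phiDerivC (-z ^ 2) = Y' at *
    generalize psiBilateralC z = p at *
    generalize psiBilateralC (z ^ 2) = P at *
    have e7 : p ^ 4 = 4 * F ^ 2 * P ^ 2 := by linear_combination (p ^ 2 + 2 * (F * P)) * e6
    have e8 : (X' * G - Y' * F) * (4 * f * g * F) = G * z * P ^ 2 * (X * g - Y * f) := by
      linear_combination -(f * g * G) * e3 - 4 * F ^ 2 * Y' * e2 + G * F ^ 2 * e4 +
        G * (f * Y + g * X) / 2 * e1 + G * (X * g - Y * f) / 2 * e5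
    rw [div_eq_div_iff (by simp [hF, hG, hP]) (by simp [hf, hg, hp]), e7]
    field_simp
    linear_combination e8

/-- The Lambert series `Σ_{n ∈ ℤ} n² / (qⁿ + q⁻ⁿ)` as a theta product. -/
lemma sechSqSum_eq (hq0 : q ≠ 0) (hq : ‖q‖ < 1) :
    sechSqSum q = 2 * q * (phiC q ^ 2 * psiC (q ^ 2) ^ 4) := by
  have hf := phiC_ne_zero hq0 hq
  have hg := phiC_neg_ne_zero hq0 hq
  have e1 := sechSum_mul_phiC_neg hq0 hq
  have e2 := sechSqSum_mul_phiC_neg hq0 hq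
  have e3 := two_mul_sechSum hq0 hq
  have e4 := phiDerivC_wronskian hq0 hq
  rw [psiBilateralC_eq hq] at e4
  refine mul_right_cancel₀ (mul_ne_zero hf hg) ?_
  linear_combination phiC q * e2 - phiDerivC q * e1 + sechSum q / 4 * e4 +
    2 * q * psiC (q ^ 2) ^ 4 * phiC q * phiC (-q) * e3

end Limit

/-! ### Expansion and termwise integration -/

section Integral

lemma summable_sq_mul_pow_odd_multiple {r : ℝ} (h0 : 0 ≤ r) (h1 : r < 1) :
    Summable fun p : ℕ × ℕ => (p.1 : ℝ) ^ 2 * r ^ (p.1 * (2 * p.2 + 1)) := by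
  have hs := (summable_pow_mul_geometric_of_norm_lt_one 2 (r := r)
    (by rwa [Real.norm_of_nonneg h0])).mul_of_nonneg (summable_geometric_of_lt_one h0 h1)
    (fun n => by positivity) (fun n => by positivity)
  refine Summable.of_nonneg_of_le (fun p => by positivity) (fun ⟨n, j⟩ => ?_) hs
  rcases Nat.eq_zero_or_pos n with rfl | hn
  · simp
  · simp only [mul_assoc, ← pow_add]
    gcongr ?_ * ?_
    exact pow_le_pow_of_le_one h0 h1.le (by nlinarith)

lemma hasSum_theta_product {u : ℂ} (hu0 : u ≠ 0) (hu : ‖u‖ < 1) :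
    HasSum (fun p : ℕ × ℕ => (p.1 : ℂ) ^ 2 * ((-1) ^ p.2 * u ^ (p.1 * (2 * p.2 + 1))))
      (u * (phiC u ^ 2 * psiC (u ^ 2) ^ 4)) := by
  have hsum : Summable fun p : ℕ × ℕ =>
      (p.1 : ℂ) ^ 2 * ((-1) ^ p.2 * u ^ (p.1 * (2 * p.2 + 1))) := by
    refine Summable.of_norm ?_
    simpa using summable_sq_mul_pow_odd_multiple (norm_nonneg u) hu
  have hfib (n : ℕ) : HasSum (fun j : ℕ => (n : ℂ) ^ 2 * ((-1) ^ j * u ^ (n * (2 * j + 1))))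
      ((n : ℂ) ^ 2 * sechC u n) := by
    rcases Nat.eq_zero_or_pos n with rfl | hn
    · simp
    refine HasSum.mul_left _ ?_
    have hlt : ‖-u ^ (2 * n)‖ < 1 := by
      rw [norm_neg, norm_pow]
      exact pow_lt_one₀ (norm_nonneg _) hu (by omega)
    have h := (hasSum_geometric_of_norm_lt_one hlt).mul_left (u ^ n)
    rw [sub_neg_eq_add, ← div_eq_mul_inv] at h
    rw [sechC, Int.natAbs_natCast]
    refine h.congr_fun ?_
    intro j
    rw [neg_pow (u ^ (2 * n)), ← pow_mul]
    ring
  have h1 := hsum.hasSum.prod_fiberwise hfib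
  have h2 := h1.of_nat_of_neg (f := fun n : ℤ => (n : ℂ) ^ 2 * sechC u n)
    (g' := ∑' p : ℕ × ℕ, (p.1 : ℂ) ^ 2 * ((-1) ^ p.2 * u ^ (p.1 * (2 * p.2 + 1))))
    (by simpa [sechC_neg] using h1)
  have h3 := h2.tsum_eq
  rw [← sechSqSum, sechSqSum_eq hu0 hu] at h3
  convert hsum.hasSum using 1
  simp only [Int.cast_zero] at h3
  linear_combination h3 / 2

lemma hasSum_integral_theta_product {c : ℂ} (hc0 : c ≠ 0) (hc : ‖c‖ < 1) :
    HasSum (fun p : ℕ × ℕ => (p.1 : ℂ) * (-1) ^ p.2 / (2 * p.2 + 1) * c ^ (p.1 * (2 * p.2 + 1)))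
      (∫ t in (0 : ℝ)..1, (phiC ((t : ℂ) * c) ^ 2 * psiC (((t : ℂ) * c) ^ 2) ^ 4) * c) := by
  have hb := summable_sq_mul_pow_odd_multiple (norm_nonneg c) hc
  have h := intervalIntegral.hasSum_integral_of_dominated_convergence (a := 0) (b := 1)
    (μ := MeasureTheory.volume)
    (F := fun (p : ℕ × ℕ) (t : ℝ) => (p.1 : ℂ) ^ 2 * ((-1) ^ p.2 * c ^ (p.1 * (2 * p.2 + 1))) *
      ((t ^ (p.1 * (2 * p.2 + 1) - 1) : ℝ) : ℂ))
    (f := fun t : ℝ => (phiC ((t : ℂ) * c) ^ 2 * psiC (((t : ℂ) * c) ^ 2) ^ 4) * c)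
    (fun p _ => (p.1 : ℝ) ^ 2 * ‖c‖ ^ (p.1 * (2 * p.2 + 1)))
    (fun p => Continuous.aestronglyMeasurable (by fun_prop))
    (fun p => .of_forall fun t ht => ?_) (.of_forall fun t _ => hb)
    intervalIntegrable_const (.of_forall fun t ht => ?_)
  · refine h.congr_fun ?_
    rintro ⟨n, j⟩
    rw [intervalIntegral.integral_const_mul, intervalIntegral.integral_ofReal, integral_pow]
    rcases Nat.eq_zero_or_pos n with rfl | hn
    · simp
    have hk : 1 ≤ n * (2 * j + 1) := Nat.mul_pos hn (by omega)
    have hj : (2 * (j : ℂ) + 1) ≠ 0 := by exact_mod_cast (by omega : 2 * j + 1 ≠ 0)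
    have hn' : (n : ℂ) ≠ 0 := by exact_mod_cast hn.ne'
    rw [Nat.cast_sub hk, Nat.sub_add_cancel hk]
    push_cast
    simp only [one_pow, zero_pow (by omega : n * (2 * j + 1) ≠ 0), sub_add_cancel, sub_zero]
    field_simp
  · rw [Set.uIoc_of_le zero_le_one] at ht
    have : ‖((t ^ (p.1 * (2 * p.2 + 1) - 1) : ℝ) : ℂ)‖ ≤ 1 := by
      rw [Complex.norm_real, Real.norm_of_nonneg (pow_nonneg ht.1.le _)]
      exact pow_le_one₀ ht.1.le ht.2
    rw [norm_mul]
    refine (mul_le_of_le_one_right (norm_nonneg _) this).trans_eq ?_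
    simp
  · rw [Set.uIoc_of_le zero_le_one] at ht
    have ht0 : (t : ℂ) ≠ 0 := by exact_mod_cast ht.1.ne'
    have hu : ‖(t : ℂ) * c‖ < 1 := by
      rw [norm_mul, Complex.norm_real, Real.norm_of_nonneg ht.1.le]
      exact (mul_le_of_le_one_left (norm_nonneg _) ht.2).trans_lt hc
    have h := (hasSum_theta_product (mul_ne_zero ht0 hc0) hu).mul_left (t : ℂ)⁻¹
    rw [show (t : ℂ)⁻¹ * ((t : ℂ) * c * (phiC ((t : ℂ) * c) ^ 2 * psiC (((t : ℂ) * c) ^ 2) ^ 4)) =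
      (phiC ((t : ℂ) * c) ^ 2 * psiC (((t : ℂ) * c) ^ 2) ^ 4) * c by field_simp] at h
    refine h.congr_fun ?_
    rintro ⟨n, j⟩
    rcases Nat.eq_zero_or_pos n with rfl | hn
    · simp
    have hk : 1 ≤ n * (2 * j + 1) := Nat.mul_pos hn (by omega)
    simp only
    rw [mul_pow, Complex.ofReal_pow, pow_sub₀ _ ht0 hk, pow_one]
    ring

/-- The sum `Σ l Im(wˡ)`. -/
noncomputable def imLambert (w : ℂ) : ℝ := ∑' l : ℕ, (l : ℝ) * (w ^ l).im

lemma imLambert_conj (w : ℂ) : imLambert ((starRingEnd ℂ) w) = -imLambert w := by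
  rw [imLambert, imLambert, ← tsum_neg]
  refine tsum_congr fun l => ?_
  rw [← map_pow, Complex.conj_im, mul_neg]

lemma imLambert_ofReal (r : ℝ) : imLambert (r : ℂ) = 0 := by
  simp [imLambert, ← Complex.ofReal_pow]

lemma im_integral_theta_product {c : ℂ} (hc0 : c ≠ 0) (hc : ‖c‖ < 1) :
    (∫ t in (0 : ℝ)..1, (phiC ((t : ℂ) * c) ^ 2 * psiC (((t : ℂ) * c) ^ 2) ^ 4) * c).im =
      ∑' j : ℕ, (-1) ^ j / (2 * j + 1) * imLambert (c ^ (2 * j + 1)) := by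
  have h := Complex.hasSum_im (hasSum_integral_theta_product hc0 hc)
  rw [← h.tsum_eq, ← (Equiv.prodComm ℕ ℕ).tsum_eq]
  refine ((Equiv.prodComm ℕ ℕ).summable_iff.mpr h.summable).tsum_prod.trans ?_
  refine tsum_congr fun j => ?_
  rw [imLambert, ← tsum_mul_left]
  refine tsum_congr fun l => ?_
  simp only [Function.comp_apply, Equiv.prodComm_apply, Prod.swap_prod_mk]
  rw [show (l : ℂ) * (-1) ^ j / (2 * j + 1) = (((l : ℝ) * (-1) ^ j / (2 * j + 1) : ℝ) : ℂ) by
    push_cast; rfl, Complex.im_ofReal_mul, ← pow_mul, mul_comm (2 * j + 1) l]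
  ring

end Integral

/-! ### The lattice sum -/

section Lattice

lemma norm_cubeRoot_mul_exp_lt_one {y : ℝ} (hy : 0 < y) :
    ‖Complex.exp (2 * π * Complex.I / 3) * (Real.exp (-π * y / 3) : ℝ)‖ < 1 := by
  rw [norm_mul, show (2 * π * Complex.I / 3 : ℂ) = ((2 * π / 3 : ℝ) : ℂ) * Complex.I by
    push_cast; ring, Complex.norm_exp_ofReal_mul_I, one_mul, Complex.norm_real,
    Real.norm_of_nonneg (Real.exp_pos _).le, Real.exp_lt_one_iff]
  have := mul_pos pi_pos hy
  linarith

lemma tsum_lattice_row {y : ℝ} (hy : 0 < y) :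
    ∑' k : ℤ, (3 * (k : ℝ) + 1) / (4 * (3 * (k : ℝ) + 1) ^ 2 + y ^ 2) ^ 2 =
      π ^ 2 / (36 * y) *
        imLambert (Complex.exp (2 * π * Complex.I / 3) * (Real.exp (-π * y / 3) : ℝ)) := by
  let w : ℂ := ⟨1 / 3, y / 6⟩
  have hw : w = 1 / 3 + y / 6 * Complex.I := by
    apply Complex.ext <;> simp [w]
  let z : UpperHalfPlane := ⟨w, by simp only [w]; positivity⟩
  have hz : (z : ℂ) = w := rfl
  have hexp : Complex.exp (2 * π * Complex.I * w) =
      Complex.exp (2 * π * Complex.I / 3) * (Real.exp (-π * y / 3) : ℝ) := by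
    rw [Complex.ofReal_exp, ← Complex.exp_add, hw]
    congr 1
    push_cast
    linear_combination (π * y / 3 : ℂ) * Complex.I_sq
  have hnorm := norm_cubeRoot_mul_exp_lt_one hy
  have key := congrArg Complex.im (EisensteinSeries.qExpansion_identity le_rfl z)
  rw [hz, hexp] at key
  have hs1 : Summable fun n : ℤ => 1 / (w + n) ^ (1 + 1) := by
    have := EisensteinSeries.linear_right_summable w 1 (k := 2) le_rfl
    refine this.congr fun n => ?_
    rw [one_div]
    simp only [Int.cast_one, one_mul]
    rfl
  have hs2 := summable_pow_mul_geometric_of_norm_lt_one 1 hnorm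
  rw [Complex.im_tsum hs1, show ((-2 * π * Complex.I) ^ (1 + 1) / (Nat.factorial 1 : ℂ) : ℂ) =
    ((-4 * π ^ 2 : ℝ) : ℂ) by
      push_cast [Nat.factorial_one]; linear_combination (4 * π ^ 2 : ℂ) * Complex.I_sq,
    Complex.im_ofReal_mul, Complex.im_tsum hs2] at key
  have hr : ∑' l : ℕ, (((l : ℂ) ^ 1 * (Complex.exp (2 * π * Complex.I / 3) *
      (Real.exp (-π * y / 3) : ℝ)) ^ l).im) =
      imLambert (Complex.exp (2 * π * Complex.I / 3) * (Real.exp (-π * y / 3) : ℝ)) := by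
    refine tsum_congr fun l => ?_
    rw [pow_one, ← Complex.ofReal_natCast, Complex.im_ofReal_mul]
  have hl (n : ℤ) : (1 / (w + n) ^ (1 + 1)).im = (-144 * y) *
      ((3 * (n : ℝ) + 1) / (4 * (3 * (n : ℝ) + 1) ^ 2 + y ^ 2) ^ 2) := by
    have hpos : 0 < (1 / 3 + (n : ℝ)) ^ 2 + (y / 6) ^ 2 := by positivity
    have hpos' : 0 < 4 * (3 * (n : ℝ) + 1) ^ 2 + y ^ 2 := by positivity
    have hns : Complex.normSq ((w + n) ^ (1 + 1)) =
        ((4 * (3 * (n : ℝ) + 1) ^ 2 + y ^ 2) / 36) ^ 2 := by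
      rw [map_pow, Complex.normSq_apply]
      simp [w]
      ring
    rw [one_div, Complex.inv_im, hns]
    have him : ((w + n) ^ (1 + 1)).im = (3 * (n : ℝ) + 1) * y / 9 := by
      simp [w, pow_succ]
      ring
    rw [him]
    field_simp
    ring
  rw [hr] at key
  simp only [hl, tsum_mul_left] at key
  generalize imLambert _ = A at key ⊢
  generalize (∑' k : ℤ, (_ : ℝ)) = T at key ⊢
  field_simp
  linear_combination -key / 4

lemma summable_rpow_linear {a b : ℝ} (ha : 0 < a) :
    Summable fun k : ℤ => 1 / |a * (k : ℝ) + b| ^ (3 / 2 : ℝ) := by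
  have h := ((Real.summable_one_div_int_add_rpow (b / a) (3 / 2)).mpr (by norm_num)).mul_left
    (1 / a ^ (3 / 2 : ℝ))
  refine h.congr fun k => ?_
  rw [show a * (k : ℝ) + b = a * ((k : ℝ) + b / a) by field_simp, abs_mul, abs_of_pos ha,
    Real.mul_rpow ha.le (abs_nonneg _), one_div_mul_one_div]

lemma div_sq_le_rpow {a b S : ℝ} (ha : 0 < a) (hb : 0 < b) (h1 : a ^ 2 ≤ S) (h2 : b ^ 2 ≤ S) :
    a / S ^ 2 ≤ 1 / a ^ (3 / 2 : ℝ) * (1 / b ^ (3 / 2 : ℝ)) := by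
  have hS : 0 < S := (pow_pos ha 2).trans_le h1
  have e1 : a ^ (5 / 2 : ℝ) ≤ S ^ (5 / 4 : ℝ) := by
    have := Real.rpow_le_rpow (by positivity) h1 (show (0 : ℝ) ≤ 5 / 4 by norm_num)
    rwa [← Real.rpow_natCast, ← Real.rpow_mul ha.le, show ((2 : ℕ) : ℝ) * (5 / 4) = 5 / 2 by
      norm_num] at this
  have e2 : b ^ (3 / 2 : ℝ) ≤ S ^ (3 / 4 : ℝ) := by
    have := Real.rpow_le_rpow (by positivity) h2 (show (0 : ℝ) ≤ 3 / 4 by norm_num)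
    rwa [← Real.rpow_natCast, ← Real.rpow_mul hb.le, show ((2 : ℕ) : ℝ) * (3 / 4) = 3 / 2 by
      norm_num] at this
  have e3 : S ^ (5 / 4 : ℝ) * S ^ (3 / 4 : ℝ) = S ^ 2 := by
    rw [← Real.rpow_add hS, ← Real.rpow_natCast]; norm_num
  have e4 : a * a ^ (3 / 2 : ℝ) = a ^ (5 / 2 : ℝ) := by
    nth_rw 1 [← Real.rpow_one a]
    rw [← Real.rpow_add ha]; norm_num
  rw [one_div_mul_one_div, div_le_div_iff₀ (by positivity) (by positivity), one_mul, ← mul_assoc,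
    e4, ← e3]
  gcongr

lemma three_mul_add_one_ne_zero (k : ℤ) : 3 * (k : ℝ) + 1 ≠ 0 := by
  exact_mod_cast (by omega : 3 * k + 1 ≠ 0)

lemma six_mul_add_one_ne_zero (n : ℤ) : 6 * (n : ℝ) + 1 ≠ 0 := by
  exact_mod_cast (by omega : 6 * n + 1 ≠ 0)

lemma summable_lattice {x : ℝ} (hx : 0 < x) :
    Summable fun p : ℤ × ℤ => (-1 : ℝ) ^ (p.1) * (3 * (p.2 : ℝ) + 1) /
      (4 * (3 * (p.2 : ℝ) + 1) ^ 2 + x ^ 2 * (6 * (p.1 : ℝ) + 1) ^ 2) ^ 2 := by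
  have hs := (summable_rpow_linear (a := x * 6) (b := x) (by positivity)).mul_of_nonneg
    (summable_rpow_linear (a := 3) (b := 1) (by norm_num))
    (fun _ => by positivity) (fun _ => by positivity)
  refine Summable.of_norm_bounded hs fun ⟨n, k⟩ => ?_
  have hA := abs_pos.mpr (three_mul_add_one_ne_zero k)
  have hB := abs_pos.mpr (mul_ne_zero hx.ne' (six_mul_add_one_ne_zero n))
  have hsgn : ‖(-1 : ℝ) ^ n‖ = 1 := by rw [norm_zpow]; simp
  rw [norm_div, norm_mul, hsgn, one_mul, norm_pow, Real.norm_eq_abs, Real.norm_eq_abs,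
    abs_of_nonneg (by positivity : 0 ≤ 4 * (3 * (k : ℝ) + 1) ^ 2 + x ^ 2 * (6 * (n : ℝ) + 1) ^ 2)]
  refine (div_sq_le_rpow hA hB ?_ ?_).trans_eq ?_
  · rw [sq_abs]; nlinarith [sq_nonneg (3 * (k : ℝ) + 1), sq_nonneg (x * (6 * (n : ℝ) + 1))]
  · rw [sq_abs]; nlinarith [sq_nonneg (3 * (k : ℝ) + 1)]
  · rw [mul_comm, show x * (6 * (n : ℝ) + 1) = x * 6 * n + x by ring]

lemma F14_eq_tsum_imLambert {x : ℝ} (hx : 0 < x) :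
    F14 x = 25 * ∑' n : ℤ, (-1 : ℝ) ^ n * (π ^ 2 / (36 * (x * |6 * (n : ℝ) + 1|)) *
      imLambert (Complex.exp (2 * π * Complex.I / 3) *
        (Real.exp (-π * (x * |6 * (n : ℝ) + 1|) / 3) : ℝ))) := by
  rw [F14, (summable_lattice hx).tsum_prod]
  congr 1
  refine tsum_congr fun n => ?_
  rw [← tsum_lattice_row (mul_pos hx (abs_pos.mpr (six_mul_add_one_ne_zero n))), ← tsum_mul_left]
  refine tsum_congr fun k => ?_
  rw [mul_pow x, sq_abs, mul_div_assoc]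

end Lattice

/-! ### Matching the two expansions -/

section Matching

lemma cubeRoot_pow_three : Complex.exp (2 * π * Complex.I / 3) ^ 3 = 1 := by
  rw [← Complex.exp_nat_mul, ← Complex.exp_two_pi_mul_I]
  congr 1
  push_cast
  ring

lemma cubeRoot_sq : Complex.exp (2 * π * Complex.I / 3) ^ 2 =
    (starRingEnd ℂ) (Complex.exp (2 * π * Complex.I / 3)) := by
  rw [← Complex.exp_conj, ← Complex.exp_nat_mul, ← mul_one (Complex.exp ((starRingEnd ℂ) _)),
    ← Complex.exp_two_pi_mul_I, ← Complex.exp_add]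
  congr 1
  simp only [map_mul, map_div₀, Complex.conj_I, Complex.conj_ofReal, map_ofNat]
  push_cast
  ring

lemma cubeRoot_mul_exp_pow (x : ℝ) (m : ℕ) :
    (Complex.exp (2 * π * Complex.I / 3) * (Real.exp (-π * x / 3) : ℝ)) ^ m =
      Complex.exp (2 * π * Complex.I / 3) ^ m * (Real.exp (-π * (x * m) / 3) : ℝ) := by
  rw [mul_pow, ← Complex.ofReal_pow, ← Real.exp_nat_mul,
    show (m : ℝ) * (-π * x / 3) = -π * (x * m) / 3 by ring]

/-- The index `j` for which `2 * j + 1 = |6 * n + 1|`. -/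
def oddIndex (n : ℤ) : ℕ := (6 * n + 1).natAbs / 2

lemma oddIndex_injective : Function.Injective oddIndex := by
  intro m n h
  simp only [oddIndex] at h
  omega

lemma two_mul_oddIndex_add_one (n : ℤ) : 2 * oddIndex n + 1 = (6 * n + 1).natAbs := by
  simp only [oddIndex]
  omega

lemma oddIndex_natCast (k : ℕ) : oddIndex k = 3 * k := by
  simp only [oddIndex]
  omega

lemma oddIndex_negSucc (k : ℕ) : oddIndex (Int.negSucc k) = 3 * k + 2 := by
  simp only [oddIndex]
  omega

lemma mem_range_oddIndex_or (j : ℕ) : j ∈ Set.range oddIndex ∨ ∃ k, j = 3 * k + 1 := by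
  obtain ⟨k, rfl | rfl | rfl⟩ : ∃ k, j = 3 * k ∨ j = 3 * k + 1 ∨ j = 3 * k + 2 :=
    ⟨j / 3, by omega⟩
  · exact .inl ⟨k, oddIndex_natCast k⟩
  · exact .inr ⟨k, rfl⟩
  · exact .inl ⟨Int.negSucc k, oddIndex_negSucc k⟩

lemma neg_one_pow_oddIndex_mul_imLambert (x : ℝ) (n : ℤ) :
    (-1 : ℝ) ^ oddIndex n * imLambert ((Complex.exp (2 * π * Complex.I / 3) *
        (Real.exp (-π * x / 3) : ℝ)) ^ (2 * oddIndex n + 1)) =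
      (-1 : ℝ) ^ n * imLambert (Complex.exp (2 * π * Complex.I / 3) *
        (Real.exp (-π * (x * (2 * oddIndex n + 1 : ℕ)) / 3) : ℝ)) := by
  rw [cubeRoot_mul_exp_pow]
  generalize Real.exp (-π * (x * (2 * oddIndex n + 1 : ℕ)) / 3) = r
  cases n with
  | ofNat k =>
    rw [Int.ofNat_eq_natCast, oddIndex_natCast, zpow_natCast, pow_mul (-1 : ℝ),
      show 2 * (3 * k) + 1 = 3 * (2 * k) + 1 by ring, pow_succ (Complex.exp _),
      pow_mul _ 3 (2 * k), cubeRoot_pow_three]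
    norm_num
  | negSucc k =>
    rw [oddIndex_negSucc, zpow_negSucc, show 2 * (3 * k + 2) + 1 = 3 * (2 * k + 1) + 2 by ring,
      pow_add (Complex.exp _), pow_mul _ 3 (2 * k + 1), cubeRoot_pow_three, one_pow, one_mul, cubeRoot_sq,
      ← Complex.conj_ofReal r, ← map_mul, imLambert_conj, pow_add, pow_mul,
      Complex.conj_ofReal]
    rcases neg_one_pow_eq_or ℝ k with h | h <;> norm_num [pow_succ, h]

lemma imLambert_cubeRoot_mul_exp_pow (x : ℝ) (k : ℕ) :
    imLambert ((Complex.exp (2 * π * Complex.I / 3) *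
      (Real.exp (-π * x / 3) : ℝ)) ^ (2 * (3 * k + 1) + 1)) = 0 := by
  rw [cubeRoot_mul_exp_pow, show 2 * (3 * k + 1) + 1 = 3 * (2 * k + 1) by ring, pow_mul _ 3,
    cubeRoot_pow_three, one_pow, one_mul, imLambert_ofReal]

end Matching

/-- For `x > 0`, with `q = e^{-πx/3}` and `ρ = e^{2πi/3}`,
`F_{(1,4)}(x) = (25π²/(36x)) Im ∫₀^{ρq} φ(u)²ψ(u²)⁴ du`,
the integral being over the straight segment from `0` to `ρq`. -/
theorem stmt_8 (x : ℝ) (hx : 0 < x) (q : ℝ) (hq : q = Real.exp (-π*x/3))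
    (ρ : ℂ) (hρ : ρ = Complex.exp (2*π*Complex.I/3)) :
    F14 x = 25*π^2/(36*x) *
      (∫ t in (0:ℝ)..1,
        (phiC ((t:ℂ)*(ρ*(q:ℂ)))^2 * psiC (((t:ℂ)*(ρ*(q:ℂ)))^2)^4) * (ρ*(q:ℂ))).im := by
  subst hq hρ
  have hc0 : Complex.exp (2 * π * Complex.I / 3) * (Real.exp (-π * x / 3) : ℝ) ≠ 0 :=
    mul_ne_zero (Complex.exp_ne_zero _) (Complex.ofReal_ne_zero.mpr (Real.exp_pos _).ne')
  rw [F14_eq_tsum_imLambert hx, im_integral_theta_product hc0 (norm_cubeRoot_mul_exp_lt_one hx),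
    ← oddIndex_injective.tsum_eq, ← tsum_mul_left, ← tsum_mul_left]
  · refine tsum_congr fun n => ?_
    have habs : |6 * (n : ℝ) + 1| = ((2 * oddIndex n + 1 : ℕ) : ℝ) := by
      rw [two_mul_oddIndex_add_one, Nat.cast_natAbs]
      push_cast
      rfl
    have h := neg_one_pow_oddIndex_mul_imLambert x n
    rw [← habs] at h
    have hcast : 2 * (oddIndex n : ℝ) + 1 = |6 * (n : ℝ) + 1| := by rw [habs]; push_cast; rfl
    have hne := abs_ne_zero.mpr (six_mul_add_one_ne_zero n)
    rw [hcast, mul_left_comm ((-1 : ℝ) ^ n), ← h]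
    generalize imLambert _ = A
    field_simp
  · intro j hj
    refine (mem_range_oddIndex_or j).resolve_right ?_
    rintro ⟨k, rfl⟩
    exact hj (by simp only [imLambert_cubeRoot_mul_exp_pow, mul_zero])
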